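/- The Josephus function J with reduction constant 3 has infinitely many fixed points: the set {n ∈ ℕ : n ≥ 1 and J(n) = n} is infinite. -/

import Mathlib

/-- The Josephus function with reduction constant 3:
`J 1 = 1` and `J n = ((J (n-1) + 2) % n) + 1` for `n ≥ 2`. -/
def J : ℕ → ℕ
  | 0 => 0
  | 1 => 1
  | n + 2 => (J (n + 1) + 2) % (n + 2) + 1

/-- `n ≥ 1` is a high extremal point if `J n ∈ {n-1, n}`. -/
def IsHighExtremal (n : ℕ) : Prop := 1 ≤ n ∧ (J n = n - 1 ∨ J n = n)

theorem J_succ {n : ℕ} (hn : 1 ≤ n) : J (n + 1) = (J n + 2) % (n + 1) + 1 := by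
  obtain ⟨k, rfl⟩ := Nat.exists_eq_add_of_le' hn
  rfl

/-- As long as no reduction occurs, `J` grows by `3` at each step. -/
theorem J_add {m : ℕ} (hm : 1 ≤ m) (k : ℕ) (h : J m + 2 * k ≤ m) :
    J (m + k) = J m + 3 * k := by
  induction k with
  | zero => simp
  | succ k ih =>
    have ih := ih (by omega)
    rw [← add_assoc, J_succ (Nat.le_add_right_of_le hm), ih, Nat.mod_eq_of_lt (by omega)]
    omega

theorem J_succ_of_eq_self {n : ℕ} (hn : 1 ≤ n) (h : J n = n) : J (n + 1) = 2 := by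
  rw [J_succ hn, h, show n + 2 = 1 + (n + 1) by omega, Nat.add_mod_right,
    Nat.mod_eq_of_lt (by omega)]

theorem J_succ_of_add_one_eq {n : ℕ} (hn : 1 ≤ n) (h : J n + 1 = n) : J (n + 1) = 1 := by
  rw [J_succ hn, show J n + 2 = n + 1 by omega, Nat.mod_self]

/-- A high extremal point that is not fixed is followed by a fixed point. The induction bounds
the 2-adic valuation of `n + 1`, which drops while the high extremal points are not fixed. -/
theorem exists_fixed_gt_of_add_one_eq (k : ℕ) :
    ∀ n, 1 ≤ n → ¬ 2 ^ k ∣ n + 1 → J n + 1 = n → ∃ m, n < m ∧ J m = m := by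
  induction k with
  | zero => simp
  | succ k ih =>
    intro n hn hk h
    have h₁ := J_succ_of_add_one_eq hn h
    have h₂ := J_add (m := n + 1) (by omega) (n / 2) (by omega)
    obtain ⟨j, hj⟩ | ⟨j, hj⟩ := n.even_or_odd
    · exact ⟨n + 1 + n / 2, by omega, by omega⟩
    · have hdvd : ¬ 2 ^ k ∣ n + 1 + n / 2 + 1 := by
        intro hd
        rw [show n + 1 + n / 2 + 1 = 3 * (j + 1) by omega] at hd
        have hcop : Nat.Coprime (2 ^ k) 3 := Nat.Coprime.pow_left k (by norm_num)
        apply hk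
        rw [pow_succ', show n + 1 = 2 * (j + 1) by omega]
        exact mul_dvd_mul_left 2 (hcop.dvd_of_dvd_mul_left hd)
      obtain ⟨m, hm, hJ⟩ := ih (n + 1 + n / 2) (by omega) hdvd (by omega)
      exact ⟨m, by omega, hJ⟩

theorem exists_fixed_gt_of_eq_self {n : ℕ} (hn : 1 ≤ n) (h : J n = n) :
    ∃ m, n < m ∧ J m = m := by
  have h₁ := J_succ_of_eq_self hn h
  have h₂ := J_add (m := n + 1) (by omega) ((n - 1) / 2) (by omega)
  obtain ⟨j, hj⟩ | ⟨j, hj⟩ := n.even_or_odd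
  · obtain ⟨m, hm, hJ⟩ := exists_fixed_gt_of_add_one_eq (n + 1 + (n - 1) / 2 + 1)
      (n + 1 + (n - 1) / 2) (by omega)
      (Nat.not_dvd_of_pos_of_lt (by omega) Nat.lt_two_pow_self) (by omega)
    exact ⟨m, by omega, hJ⟩
  · exact ⟨n + 1 + (n - 1) / 2, by omega, by omega⟩

theorem stmt_18 : {n : ℕ | 1 ≤ n ∧ J n = n}.Infinite := by
  refine Set.infinite_of_forall_exists_gt fun a => ?_
  induction a with
  | zero => exact ⟨1, ⟨le_rfl, rfl⟩, one_pos⟩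
  | succ a ih =>
    obtain ⟨b, ⟨hb, hJ⟩, hab⟩ := ih
    obtain ⟨m, hm, hJm⟩ := exists_fixed_gt_of_eq_self hb hJ
    exact ⟨m, ⟨by omega, hJm⟩, by omega⟩
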